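/- Let A and B be simple unital complex C*-algebras with A oddly decomposable, φ : GL(A) → GL(B) a group isomorphism, and θ the induced map on idempotents. Then for every pair of nontrivial idempotents e, f ∈ Ĩ(A) there exist nontrivial idempotents e', f' ∈ Ĩ(A) and an invertible u ∈ GL(A) such that e' ∼_c f, f' ∼_c f, e'e = ee' = e' ≠ e, f'f = ff' = f' ≠ f, and e' = u f' u⁻¹. -/

import Mathlib

noncomputable section

/-- The symmetry `1 - 2e` associated to an idempotent `e` is a unit (its own inverse). -/
def symUnit {A : Type*} [Ring A] {e : A} (he : IsIdempotentElem e) : Aˣ where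
  val := 1 - 2 * e
  inv := 1 - 2 * e
  val_inv := by
    have h : e * e = e := he
    have expand : (1 - 2 * e) * (1 - 2 * e) = 1 - 4 * e + 4 * (e * e) := by noncomm_ring
    rw [expand, h]; noncomm_ring
  inv_val := by
    have h : e * e = e := he
    have expand : (1 - 2 * e) * (1 - 2 * e) = 1 - 4 * e + 4 * (e * e) := by noncomm_ring
    rw [expand, h]; noncomm_ring

/-- The map `θ_φ` induced on idempotents by a map `φ` between the groups of invertible
elements, determined by `1 - 2 θ_φ(e) = φ(1 - 2e)`, i.e. `θ_φ(e) = (1 - φ(1 - 2e))/2`;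
it is extended by `0` off the set of idempotents. -/
noncomputable def theta {A B : Type*} [Ring A] [Ring B] [Algebra ℂ B]
    (φ : Aˣ → Bˣ) (e : A) : B :=
  letI := Classical.propDecidable (IsIdempotentElem e)
  if h : IsIdempotentElem e then (2 : ℂ)⁻¹ • ((1 : B) - (φ (symUnit h) : B)) else 0

/-- `a` and `b` are coefficient maps for the idempotent `e` (w.r.t. `φ`):
`φ(λe + 1 - e) = a(λ) θ(e) + b(λ) θ(1-e)` for all nonzero `λ`. -/
def IsCoeffMaps {A B : Type*} [Ring A] [Ring B] [Algebra ℂ A] [Algebra ℂ B]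
    (φ : Aˣ → Bˣ) (e : A) (a b : ℂˣ →* ℂˣ) : Prop :=
  ∀ (lam : ℂˣ) (v : Aˣ), (v : A) = (lam : ℂ) • e + 1 - e →
    (φ v : B) = ((a lam : ℂˣ) : ℂ) • theta φ e + ((b lam : ℂˣ) : ℂ) • theta φ (1 - e)

/-- `c(λ) = a(λ) b(λ)⁻¹`, as an element of `ℂˣ`. -/
def cOf (a b : ℂˣ →* ℂˣ) (lam : ℂˣ) : ℂˣ := a lam * (b lam)⁻¹

/-- `e ∼_c f`: the functions `c_e` and `c_f` agree (for some, equivalently any,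
choice of coefficient maps). -/
def cEquiv {A B : Type*} [Ring A] [Ring B] [Algebra ℂ A] [Algebra ℂ B]
    (φ : Aˣ → Bˣ) (e f : A) : Prop :=
  ∃ ae be af bf : ℂˣ →* ℂˣ, IsCoeffMaps φ e ae be ∧ IsCoeffMaps φ f af bf ∧
    ∀ lam : ℂˣ, cOf ae be lam = cOf af bf lam

/-- A unital ring is oddly decomposable if for every pair of nontrivial idempotents
`e, f` there is an odd integer `n ≥ 3` and `n` pairwise orthogonal nontrivial
idempotents `g₁, …, gₙ` summing to `f`, such that each `gᵢ` is similar to some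
nontrivial idempotent `gᵢ'` with `gᵢ' e = e gᵢ' = gᵢ' ≠ e`. -/
def OddlyDecomposable (A : Type*) [Ring A] : Prop :=
  ∀ e f : A, IsIdempotentElem e → e ≠ 0 → e ≠ 1 → IsIdempotentElem f → f ≠ 0 → f ≠ 1 →
    ∃ n : ℕ, Odd n ∧ 3 ≤ n ∧ ∃ g : Fin n → A,
      (∀ i, IsIdempotentElem (g i) ∧ g i ≠ 0 ∧ g i ≠ 1) ∧
      (∀ i j, i ≠ j → g i * g j = 0) ∧
      (∑ i, g i) = f ∧
      ∀ i, ∃ (g' : A) (u : Aˣ), IsIdempotentElem g' ∧ g' ≠ 0 ∧ g' ≠ 1 ∧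
        g' = (u : A) * g i * ((u⁻¹ : Aˣ) : A) ∧ g' * e = g' ∧ e * g' = g' ∧ g' ≠ e

variable {A B : Type*}
  [NormedRing A] [StarRing A] [CStarRing A] [CompleteSpace A]
  [NormedAlgebra ℂ A] [StarModule ℂ A]
  [NormedRing B] [StarRing B] [CStarRing B] [CompleteSpace B]
  [NormedAlgebra ℂ B] [StarModule ℂ B]

section SimpleAlgebra

variable {S : Type*}

/-- In a simple ring the elements `x * p * y` generate `1` additively, for any `p ≠ 0`. -/
theorem simple_induction_one [Ring S] [IsSimpleRing S] {p : S} (hp : p ≠ 0) (P : S → Prop)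
    (mul : ∀ x y, P (x * p * y)) (zero : P 0) (add : ∀ x y, P x → P y → P (x + y))
    (neg : ∀ x, P x → P (-x)) : P 1 := by
  have h1 : (1 : S) ∈ TwoSidedIdeal.span {p} :=
    IsSimpleRing.one_mem_of_ne_zero_mem _ hp (TwoSidedIdeal.subset_span rfl)
  rw [TwoSidedIdeal.mem_span_iff_mem_addSubgroup_closure] at h1
  refine AddSubgroup.closure_induction (p := fun w _ => P w) ?_ zero
    (fun x y _ _ hx hy => add x y hx hy) (fun x _ hx => neg x hx) h1
  rintro _ ⟨_, ⟨x, -, _, rfl, rfl⟩, y, -, rfl⟩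
  exact mul x y

variable [NormedRing S] [NormedAlgebra ℂ S] [CompleteSpace S]

theorem exists_isUnit_algebraMap_sub (x : S) : ∃ t : ℂ, IsUnit (algebraMap ℂ S t - x) := by
  refine ⟨((‖x‖ * ‖(1 : S)‖ + 1 : ℝ) : ℂ), ?_⟩
  apply spectrum.mem_resolventSet_of_norm_lt_mul (𝕜 := ℂ)
  rw [Complex.norm_real, Real.norm_of_nonneg (by positivity)]
  linarith

theorem exists_eq_algebraMap_of_central [IsSimpleRing S] {z : S} (hz : ∀ x, z * x = x * z) :
    ∃ t : ℂ, z = algebraMap ℂ S t := by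
  obtain ⟨t, ht⟩ := spectrum.nonempty (A := S) z
  refine ⟨t, ?_⟩
  by_contra hne
  have hd : algebraMap ℂ S t - z ≠ 0 := fun h => hne (sub_eq_zero.1 h).symm
  have hc : ∀ x, (algebraMap ℂ S t - z) * x = x * (algebraMap ℂ S t - z) := fun x => by
    rw [sub_mul, mul_sub, hz, Algebra.commutes]
  apply ht
  obtain ⟨w, hw⟩ : ∃ w, (1 : S) = (algebraMap ℂ S t - z) * w := by
    refine simple_induction_one hd (fun v => ∃ w, v = (algebraMap ℂ S t - z) * w) ?_ ?_ ?_ ?_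
    · exact fun x y => ⟨x * y, by rw [← hc, mul_assoc]⟩
    · exact ⟨0, by simp⟩
    · rintro _ _ ⟨x, rfl⟩ ⟨y, rfl⟩
      exact ⟨x + y, by rw [mul_add]⟩
    · rintro _ ⟨x, rfl⟩
      exact ⟨-x, by rw [mul_neg]⟩
  exact ⟨⟨_, w, hw.symm, by rw [← hc, ← hw]⟩, rfl⟩

/-- The centre of a corner `pSp` of a simple complex Banach algebra consists of the
scalar multiples of `p`. -/
theorem exists_eq_smul_of_central_corner [IsSimpleRing S] {p z : S} (hp0 : p ≠ 0)
    (hpz : p * z = z) (hzp : z * p = z)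
    (hz : ∀ x, z * (p * x * p) = p * x * p * z) : ∃ t : ℂ, z = t • p := by
  obtain ⟨Z, hZ⟩ : ∃ Z : S, ∀ b, Z * b * p = 1 * b * z := by
    refine simple_induction_one hp0 (fun w => ∃ Z : S, ∀ b, Z * b * p = w * b * z) ?_ ?_ ?_ ?_
    · intro x y
      refine ⟨x * z * y, fun b => ?_⟩
      calc x * z * y * b * p = x * (z * p) * y * b * p := by rw [hzp]
        _ = x * (z * (p * (y * b) * p)) := by simp only [mul_assoc]
        _ = x * (p * (y * b) * (p * z)) := by rw [hz]; simp only [mul_assoc]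
        _ = x * p * y * b * z := by rw [hpz]; simp only [mul_assoc]
    · exact ⟨0, by simp⟩
    · rintro v w ⟨x, hx⟩ ⟨y, hy⟩
      exact ⟨x + y, fun b => by simp only [add_mul, hx, hy]⟩
    · rintro v ⟨x, hx⟩
      exact ⟨-x, fun b => by simp only [neg_mul, hx]⟩
  simp only [one_mul] at hZ
  have hcent : ∀ c, Z * c = c * Z := fun c => by
    have h0 : ∀ b, (Z * c - c * Z) * b * p = 0 := fun b => by
      have h1 := hZ (c * b)
      have h2 := hZ b
      rw [sub_mul, sub_mul, sub_eq_zero]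
      calc Z * c * b * p = Z * (c * b) * p := by simp only [mul_assoc]
        _ = c * (b * z) := by rw [h1, mul_assoc]
        _ = c * Z * b * p := by rw [← h2]; simp only [mul_assoc]
    have h1 : (Z * c - c * Z) * 1 = 0 := by
      refine simple_induction_one hp0 (fun w => (Z * c - c * Z) * w = 0) ?_ ?_ ?_ ?_
      · intro x y
        rw [← mul_assoc, ← mul_assoc, h0, zero_mul]
      · simp
      · intro x y hx hy
        rw [mul_add, hx, hy, add_zero]
      · intro x hx
        rw [mul_neg, hx, neg_zero]
    rwa [mul_one, sub_eq_zero] at h1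
  obtain ⟨t, ht⟩ := exists_eq_algebraMap_of_central hcent
  refine ⟨t, ?_⟩
  have h1 := hZ 1
  rw [mul_one, one_mul] at h1
  rw [← h1, ht, Algebra.smul_def]

/-- The double commutant, relative to units, of an idempotent `p` in a simple complex Banach
algebra is spanned by `p` and `1 - p`. -/
theorem exists_eq_smul_add_smul [IsSimpleRing S] {p w : S} (hp : IsIdempotentElem p)
    (hp0 : p ≠ 0) (hp1 : p ≠ 1)
    (hw : ∀ u : Sˣ, Commute (u : S) p → Commute (u : S) w) :
    ∃ s t : ℂ, w = s • p + t • (1 - p) := by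
  have key : ∀ x : S, Commute x p → Commute x w := fun x hx => by
    obtain ⟨t, u, hu⟩ := exists_isUnit_algebraMap_sub x
    have h1 := hw u (by rw [hu]; exact (Algebra.commute_algebraMap_left t p).sub_left hx)
    rw [hu] at h1
    simpa using (Algebra.commute_algebraMap_left t w).sub_left h1
  have hpw : p * w = w * p := key p (Commute.refl p)
  have hpp : p * p = p := hp
  have corner : ∀ q : S, q * q = q → q ≠ 0 → (∀ x, Commute x q → Commute x w) →
      ∃ t : ℂ, w * q = t • q := by
    intro q hq hq0 hqw
    have hc : q * w = w * q := hqw q (Commute.refl q)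
    refine exists_eq_smul_of_central_corner hq0 ?_ ?_ fun x => ?_
    · rw [← hc, ← mul_assoc, hq]
    · rw [mul_assoc, hq]
    · have h1 : q * x * q * w = w * (q * x * q) := hqw (q * x * q) (by
        change q * x * q * q = q * (q * x * q)
        rw [mul_assoc, hq, ← mul_assoc, ← mul_assoc, hq])
      calc w * q * (q * x * q) = w * (q * q * x * q) := by simp only [mul_assoc]
        _ = q * x * (q * q) * w := by rw [hq, ← h1]
        _ = q * x * q * (w * q) := by rw [← hc]; simp only [mul_assoc]
  obtain ⟨s, hs⟩ := corner p hpp hp0 key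
  obtain ⟨t, ht⟩ := corner (1 - p) hp.one_sub (sub_ne_zero.2 hp1.symm) fun x hx =>
    key x (by simpa using (Commute.one_right x).sub_right hx)
  exact ⟨s, t, by rw [← hs, ← ht]; noncomm_ring⟩

end SimpleAlgebra

section Theta

variable {R S : Type*} [Ring R] [Ring S] [Algebra ℂ S] {φ : Rˣ ≃* Sˣ} {e f : R}

theorem two_mul_left_cancel {x y : S} (h : 2 * x = 2 * y) : x = y := by
  have h2 : (2 : ℂ) • x = (2 : ℂ) • y := by simpa only [two_smul, two_mul] using h
  exact smul_right_injective S (two_ne_zero (α := ℂ)) h2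

theorem map_symUnit (he : IsIdempotentElem e) :
    (φ (symUnit he) : S) = 1 - 2 * theta φ e := by
  have h : (2 : ℂ) • theta φ e = 1 - (φ (symUnit he) : S) := by
    rw [theta, dif_pos he, smul_smul]
    norm_num
  rw [two_mul, ← two_smul ℂ, h, sub_sub_cancel]

theorem symUnit_mul_self (he : IsIdempotentElem e) : symUnit he * symUnit he = 1 :=
  Units.ext (symUnit he).val_inv

theorem isIdempotentElem_theta (he : IsIdempotentElem e) :
    IsIdempotentElem (theta φ e) := by
  have h : (φ (symUnit he * symUnit he) : S) = 1 := by rw [symUnit_mul_self]; simp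
  rw [map_mul, Units.val_mul, map_symUnit] at h
  apply two_mul_left_cancel
  apply two_mul_left_cancel
  have h2 : (1 - 2 * theta φ e) * (1 - 2 * theta φ e)
    = 1 + (2 * (2 * (theta φ e * theta φ e)) - 2 * (2 * theta φ e)) := by noncomm_ring
  rw [h2, add_eq_left, sub_eq_zero] at h
  exact h

theorem isIdempotentElem_add (he : IsIdempotentElem e) (hf : IsIdempotentElem f)
    (hef : e * f = 0) (hfe : f * e = 0) : IsIdempotentElem (e + f) := by
  change (e + f) * (e + f) = e + f
  rw [mul_add, add_mul, add_mul, he.eq, hf.eq, hef, hfe, add_zero, zero_add]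

theorem theta_add (he : IsIdempotentElem e) (hf : IsIdempotentElem f) (hef : e * f = 0)
    (hfe : f * e = 0) :
    theta φ (e + f) = theta φ e + theta φ f - 2 * (theta φ e * theta φ f) := by
  have hs := isIdempotentElem_add he hf hef hfe
  have h : symUnit hs = symUnit he * symUnit hf := Units.ext <| by
    change 1 - 2 * (e + f) = (1 - 2 * e) * (1 - 2 * f)
    have h3 : (1 - 2 * e) * (1 - 2 * f) = 1 - 2 * (e + f) + 4 * (e * f) := by noncomm_ring
    rw [h3, hef, mul_zero, add_zero]
  have h4 := congrArg (fun u => (φ u : S)) h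
  simp only [map_mul, Units.val_mul, map_symUnit] at h4
  apply two_mul_left_cancel
  have h5 : (1 - 2 * theta φ e) * (1 - 2 * theta φ f)
    = 1 - 2 * (theta φ e + theta φ f - 2 * (theta φ e * theta φ f)) := by noncomm_ring
  rw [h5] at h4
  exact sub_right_injective h4

theorem commute_theta (he : IsIdempotentElem e) (hf : IsIdempotentElem f) (h : Commute e f) :
    Commute (theta φ e) (theta φ f) := by
  have expand : ∀ x y : R,
      (1 - 2 * x) * (1 - 2 * y) = 1 - 2 * x - 2 * y + 2 * (2 * (x * y)) := fun x y => by
    noncomm_ring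
  have h1 : symUnit he * symUnit hf = symUnit hf * symUnit he := Units.ext <| by
    change (1 - 2 * e) * (1 - 2 * f) = (1 - 2 * f) * (1 - 2 * e)
    rw [expand, expand, h.eq, sub_right_comm]
  have h4 := congrArg (fun u => (φ u : S)) h1
  simp only [map_mul, Units.val_mul, map_symUnit] at h4
  have expand' : ∀ x y : S,
      (1 - 2 * x) * (1 - 2 * y) = 1 - 2 * x - 2 * y + 2 * (2 * (x * y)) := fun x y => by
    noncomm_ring
  rw [expand', expand', sub_right_comm] at h4
  exact two_mul_left_cancel (two_mul_left_cancel (add_left_cancel h4))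

theorem theta_conj (he : IsIdempotentElem e) (u : Rˣ)
    (hf : IsIdempotentElem ((u : R) * e * ((u⁻¹ : Rˣ) : R))) :
    theta φ ((u : R) * e * ((u⁻¹ : Rˣ) : R)) =
      (φ u : S) * theta φ e * (((φ u)⁻¹ : Sˣ) : S) := by
  have h : symUnit hf = u * symUnit he * u⁻¹ := Units.ext <| by
    change 1 - 2 * ((u : R) * e * ((u⁻¹ : Rˣ) : R)) = (u : R) * (1 - 2 * e) * ((u⁻¹ : Rˣ) : R)
    have : (u : R) * (1 - 2 * e) * ((u⁻¹ : Rˣ) : R) = (u : R) * ((u⁻¹ : Rˣ) : R)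
      - 2 * ((u : R) * e * ((u⁻¹ : Rˣ) : R)) := by
      simp only [two_mul, mul_sub, sub_mul, mul_add, add_mul, mul_one]
    rw [this, Units.mul_inv]
  have h4 := congrArg (fun u => (φ u : S)) h
  simp only [map_mul, map_inv, Units.val_mul, map_symUnit] at h4
  apply two_mul_left_cancel
  have h5 : (φ u : S) * (1 - 2 * theta φ e) * (((φ u)⁻¹ : Sˣ) : S)
    = (φ u : S) * (((φ u)⁻¹ : Sˣ) : S)
      - 2 * ((φ u : S) * theta φ e * (((φ u)⁻¹ : Sˣ) : S)) := by
    simp only [two_mul, mul_sub, sub_mul, mul_add, add_mul, mul_one]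
  rw [h5, Units.mul_inv] at h4
  exact sub_right_injective h4

theorem theta_one_sub (hφ : φ (-1) = -1) (he : IsIdempotentElem e) :
    theta φ (1 - e) = 1 - theta φ e := by
  have h : symUnit he.one_sub = -1 * symUnit he := Units.ext <| by
    change 1 - 2 * (1 - e) = (-1 : Rˣ) * (1 - 2 * e)
    push_cast
    noncomm_ring
  have h4 := congrArg (fun u => (φ u : S)) h
  simp only [map_mul, Units.val_mul, map_symUnit, hφ] at h4
  push_cast at h4
  apply two_mul_left_cancel
  have h5 : -1 * (1 - 2 * theta φ e) = 1 - 2 * (1 - theta φ e) := by noncomm_ring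
  rw [h5] at h4
  exact sub_right_injective h4

theorem theta_zero : theta φ (0 : R) = 0 := by
  have h : symUnit (IsIdempotentElem.zero (M₀ := R)) = 1 := Units.ext <| by
    change 1 - 2 * (0 : R) = 1
    simp
  have h4 := congrArg (fun u => (φ u : S)) h
  simp only [map_symUnit, map_one, Units.val_one] at h4
  apply two_mul_left_cancel
  rw [mul_zero]
  simpa using h4

variable [Algebra ℂ R]

theorem theta_injOn (he : IsIdempotentElem e) (hf : IsIdempotentElem f)
    (h : theta φ e = theta φ f) : e = f := by
  have h1 : φ (symUnit he) = φ (symUnit hf) := Units.ext <| by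
    rw [map_symUnit, map_symUnit, h]
  have h2 : (1 - 2 * e) = (1 - 2 * f) := congrArg Units.val (φ.injective h1)
  exact two_mul_left_cancel (sub_right_injective h2)

theorem theta_ne_zero (he : IsIdempotentElem e) (he0 : e ≠ 0) : theta φ e ≠ 0 := fun h =>
  he0 <| theta_injOn (φ := φ) he .zero (h.trans theta_zero.symm)

theorem theta_ne_one (hφ : φ (-1) = -1) (he : IsIdempotentElem e) (he1 : e ≠ 1) :
    theta φ e ≠ 1 := fun h =>
  he1 <| (sub_eq_zero.1 <| theta_injOn (φ := φ) he.one_sub .zero <| by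
    rw [theta_one_sub hφ he, h, sub_self, theta_zero]).symm

end Theta

section Coefficients

variable {R S : Type*} [Ring R] [Algebra ℂ R] {e f : R}

/-- The unit `t e + 1 - e` attached to an idempotent `e` and a nonzero scalar `t`. -/
def dilation (he : IsIdempotentElem e) (t : ℂˣ) : Rˣ where
  val := (t : ℂ) • e + 1 - e
  inv := ((t⁻¹ : ℂˣ) : ℂ) • e + 1 - e
  val_inv := by
    have h : e * e = e := he
    simp only [mul_sub, sub_mul, add_mul, mul_add, smul_mul_assoc, mul_smul_comm, h, one_mul,
      mul_one, smul_add, smul_sub, smul_smul, Units.inv_mul, one_smul]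
    abel
  inv_val := by
    have h : e * e = e := he
    simp only [mul_sub, sub_mul, add_mul, mul_add, smul_mul_assoc, mul_smul_comm, h, one_mul,
      mul_one, smul_add, smul_sub, smul_smul, Units.mul_inv, one_smul]
    abel

theorem val_dilation (he : IsIdempotentElem e) (t : ℂˣ) :
    (dilation he t : R) = (t : ℂ) • e + 1 - e := rfl

theorem dilation_one (he : IsIdempotentElem e) : dilation he 1 = 1 := Units.ext <| by
  simp [val_dilation]

theorem dilation_mul (he : IsIdempotentElem e) (s t : ℂˣ) :
    dilation he (s * t) = dilation he s * dilation he t := Units.ext <| by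
  have h : e * e = e := he
  simp only [Units.val_mul, val_dilation, mul_sub, sub_mul, add_mul, mul_add, smul_mul_assoc,
    mul_smul_comm, h, one_mul, mul_one, smul_add, smul_sub, smul_smul, mul_comm (t : ℂ)]
  abel

theorem dilation_neg_one (he : IsIdempotentElem e) : dilation he (-1) = symUnit he :=
  Units.ext <| by
    change ((-1 : ℂˣ) : ℂ) • e + 1 - e = 1 - 2 * e
    simp only [Units.val_neg, Units.val_one, neg_smul, one_smul, two_mul]
    abel

theorem dilation_add (he : IsIdempotentElem e) (hf : IsIdempotentElem f)
    (hs : IsIdempotentElem (e + f)) (hef : e * f = 0) (t : ℂˣ) :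
    dilation hs t = dilation he t * dilation hf t := Units.ext <| by
  simp only [Units.val_mul, val_dilation, mul_sub, sub_mul, add_mul, mul_add, smul_mul_assoc,
    mul_smul_comm, hef, one_mul, mul_one, smul_zero, smul_add,
    sub_zero, zero_add]
  abel

variable [Ring S] [Algebra ℂ S] {φ : Rˣ ≃* Sˣ} {a b : ℂˣ →* ℂˣ}

theorem isCoeffMaps_iff (hφ : φ (-1) = -1) (he : IsIdempotentElem e) :
    IsCoeffMaps φ e a b ↔ ∀ t, (φ (dilation he t) : S) =
      (a t : ℂ) • theta φ e + (b t : ℂ) • (1 - theta φ e) := by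
  rw [← theta_one_sub hφ he]
  refine ⟨fun h t => h t _ rfl, fun h t v hv => ?_⟩
  rw [← h t, show v = dilation he t from Units.ext hv]

theorem IsCoeffMaps.map_mul_theta (hφ : φ (-1) = -1) (he : IsIdempotentElem e)
    (h : IsCoeffMaps φ e a b) (t : ℂˣ) :
    (φ (dilation he t) : S) * theta φ e = (a t : ℂ) • theta φ e := by
  have hp := isIdempotentElem_theta (φ := φ) he
  rw [(isCoeffMaps_iff hφ he).1 h, add_mul, smul_mul_assoc, smul_mul_assoc, hp.one_sub_mul_self,
    hp.eq, smul_zero, add_zero]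

theorem IsCoeffMaps.map_mul_one_sub_theta (hφ : φ (-1) = -1) (he : IsIdempotentElem e)
    (h : IsCoeffMaps φ e a b) (t : ℂˣ) :
    (φ (dilation he t) : S) * (1 - theta φ e) = (b t : ℂ) • (1 - theta φ e) := by
  have hp := isIdempotentElem_theta (φ := φ) he
  rw [(isCoeffMaps_iff hφ he).1 h, add_mul, smul_mul_assoc, smul_mul_assoc, hp.mul_one_sub_self,
    hp.one_sub.eq, smul_zero, zero_add]

/-- The ratio of coefficient maps at `e` is the character `c`. -/
def HasRatio (φ : Rˣ ≃* Sˣ) (e : R) (c : ℂˣ →* ℂˣ) : Prop :=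
  ∃ a b : ℂˣ →* ℂˣ, IsCoeffMaps φ e a b ∧ a = c * b

theorem HasRatio.cEquiv {c : ℂˣ →* ℂˣ} (he : HasRatio φ e c) (hf : HasRatio φ f c) :
    cEquiv φ e f := by
  obtain ⟨a, b, h, rfl⟩ := he
  obtain ⟨a', b', h', rfl⟩ := hf
  exact ⟨_, b, _, b', h, h', fun t => by simp [cOf]⟩

/-- Similar idempotents have the same ratio. -/
theorem HasRatio.conj {c : ℂˣ →* ℂˣ} (hφ : φ (-1) = -1) (he : IsIdempotentElem e)
    (h : HasRatio φ e c) (u : Rˣ)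
    (hf : IsIdempotentElem ((u : R) * e * ((u⁻¹ : Rˣ) : R))) :
    HasRatio φ ((u : R) * e * ((u⁻¹ : Rˣ) : R)) c := by
  obtain ⟨a, b, h, rfl⟩ := h
  refine ⟨_, b, (isCoeffMaps_iff hφ hf).2 fun t => ?_, rfl⟩
  have h1 : dilation hf t = u * dilation he t * u⁻¹ := Units.ext <| by
    simp only [Units.val_mul, val_dilation, mul_sub, sub_mul, add_mul, mul_add, smul_mul_assoc,
      mul_smul_comm, mul_one, Units.mul_inv]
  rw [h1, map_mul, map_mul, map_inv, Units.val_mul, Units.val_mul, (isCoeffMaps_iff hφ he).1 h,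
    theta_conj he u hf]
  simp only [mul_sub, sub_mul, add_mul, mul_add, smul_mul_assoc,
      mul_smul_comm, mul_one, Units.mul_inv]

theorem eq_mul_of_eigen {v w x y : S} {α β γ : ℂ} (hxy : Commute x y) (hv : v * x = α • x)
    (hw : w * y = β • y) (hvw : v * w * (x * y) = γ • (x * y)) (h0 : x * y ≠ 0) :
    γ = α * β := by
  have h : v * w * (x * y) = (α * β) • (x * y) := by
    rw [hxy.eq, mul_assoc, ← mul_assoc w, hw, smul_mul_assoc, ← hxy.eq, mul_smul_comm,
      ← mul_assoc, hv, smul_mul_assoc, smul_smul, mul_comm]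
  exact smul_left_injective ℂ h0 (hvw.symm.trans h)

/-- Comparison of the coefficients of `e`, `f` and `e + f` on the four atoms generated
by `θ(e)` and `θ(f)`. -/
theorem coeff_relations {a' b' a'' b'' : ℂˣ →* ℂˣ} (hφ : φ (-1) = -1)
    (he : IsIdempotentElem e) (hf : IsIdempotentElem f)
    (hef : e * f = 0) (hfe : f * e = 0) (h : IsCoeffMaps φ e a b) (h' : IsCoeffMaps φ f a' b')
    (h'' : IsCoeffMaps φ (e + f) a'' b'') :
    (theta φ e * theta φ f ≠ 0 → b'' = a * a') ∧
    (theta φ e * (1 - theta φ f) ≠ 0 → a'' = a * b') ∧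
    ((1 - theta φ e) * theta φ f ≠ 0 → a'' = b * a') ∧
    ((1 - theta φ e) * (1 - theta φ f) ≠ 0 → b'' = b * b') := by
  have hs := isIdempotentElem_add he hf hef hfe
  have hc : Commute (theta φ e) (theta φ f) :=
    commute_theta he hf (show e * f = f * e by rw [hef, hfe])
  have hP := theta_add (φ := φ) he hf hef hfe
  have hp : theta φ e * theta φ e = theta φ e := isIdempotentElem_theta he
  have hq : theta φ f * theta φ f = theta φ f := isIdempotentElem_theta hf
  have h1 := h.map_mul_theta hφ he
  have h2 := h.map_mul_one_sub_theta hφ he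
  have h3 := h'.map_mul_theta hφ hf
  have h4 := h'.map_mul_one_sub_theta hφ hf
  have h5 : ∀ t, (φ (dilation he t) : S) * (φ (dilation hf t) : S) =
      (a'' t : ℂ) • theta φ (e + f) + (b'' t : ℂ) • (1 - theta φ (e + f)) := fun t => by
    rw [← (isCoeffMaps_iff hφ hs).1 h'', dilation_add he hf hs hef, map_mul, Units.val_mul]
  rw [hP] at h5
  generalize theta φ e = p at *
  generalize theta φ f = q at *
  generalize hPP : p + q - 2 * (p * q) = P at *
  have hPp : P * p = p - p * q := by
    rw [← hPP, sub_mul, add_mul, hp, mul_assoc, mul_assoc, ← hc.eq, ← mul_assoc p p q, hp, two_mul]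
    abel
  have hPq : P * q = q - p * q := by
    rw [← hPP, sub_mul, add_mul, hq, mul_assoc, mul_assoc, hq, two_mul]
    abel
  have hqp : ∀ x, q * (p * x) = p * (q * x) := fun x => by
    rw [← mul_assoc, ← hc.eq, mul_assoc]
  have key0 : ∀ x, P * x = 0 → ∀ t : ℂˣ,
      ((a'' t : ℂ) • P + (b'' t : ℂ) • (1 - P)) * x = (b'' t : ℂ) • x := fun x hx t => by
    simp only [add_mul, smul_mul_assoc, sub_mul, hx, one_mul, smul_zero, zero_add, sub_zero]
  have key1 : ∀ x, P * x = x → ∀ t : ℂˣ,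
      ((a'' t : ℂ) • P + (b'' t : ℂ) • (1 - P)) * x = (a'' t : ℂ) • x := fun x hx t => by
    simp only [add_mul, smul_mul_assoc, sub_mul, hx, one_mul, sub_self, smul_zero, add_zero]
  have hc1 : Commute p (1 - q) := (Commute.one_right p).sub_right hc
  have hc2 : Commute (1 - p) q := (Commute.one_left q).sub_left hc
  have hc3 : Commute (1 - p) (1 - q) := (Commute.one_right _).sub_right hc2
  have e1 : P * (p * q) = 0 := by
    rw [← mul_assoc, hPp, sub_mul, mul_assoc, hq, sub_self]
  have e2 : P * (p * (1 - q)) = p * (1 - q) := by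
    rw [← mul_assoc, hPp]
    simp only [mul_sub, sub_mul, mul_one, mul_assoc, hq]
    abel
  have e3 : P * ((1 - p) * q) = (1 - p) * q := by
    rw [hc2.eq, ← mul_assoc, hPq]
    simp only [mul_sub, sub_mul, mul_one, mul_assoc, ← hc.eq]
    rw [← mul_assoc, hp]
    abel
  have e4 : P * ((1 - p) * (1 - q)) = 0 := by
    have : P * ((1 - p) * (1 - q)) = P - P * p - P * q + P * (p * q) := by
      simp only [mul_sub, sub_mul, mul_one, one_mul]
      abel
    rw [this, e1, hPp, hPq, ← hPP, two_mul]
    abel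
  refine ⟨fun h0 => ?_, fun h0 => ?_, fun h0 => ?_, fun h0 => ?_⟩ <;> ext t
  · exact eq_mul_of_eigen hc (h1 t) (h3 t) (by rw [h5, key0 _ e1]) h0
  · exact eq_mul_of_eigen hc1 (h1 t) (h4 t) (by rw [h5, key1 _ e2]) h0
  · exact eq_mul_of_eigen hc2 (h2 t) (h3 t) (by rw [h5, key1 _ e3]) h0
  · exact eq_mul_of_eigen hc3 (h2 t) (h4 t) (by rw [h5, key0 _ e4]) h0

theorem HasRatio.mul_self_ne_one {c : ℂˣ →* ℂˣ} (hφ : φ (-1) = -1) (he : IsIdempotentElem e)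
    (he0 : e ≠ 0) (he1 : e ≠ 1) (h : HasRatio φ e c) : c * c ≠ 1 := by
  obtain ⟨a, b, h, rfl⟩ := h
  have h1 := h.map_mul_theta hφ he (-1)
  have h2 := h.map_mul_one_sub_theta hφ he (-1)
  have hp := isIdempotentElem_theta (φ := φ) he
  have hp0 := theta_ne_zero (φ := φ) he he0
  have hp1 := sub_ne_zero.2 (theta_ne_one hφ he he1).symm
  rw [dilation_neg_one, map_symUnit] at h1 h2
  have h3 : (((c * b) (-1) : ℂˣ) : ℂ) = -1 := smul_left_injective ℂ hp0 <| by
    simp only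
    rw [← h1, sub_mul, mul_assoc, hp.eq, neg_one_smul, one_mul, two_mul]
    abel
  have h4 : ((b (-1) : ℂˣ) : ℂ) = 1 := smul_left_injective ℂ hp1 <| by
    simp only
    rw [← h2, sub_mul, mul_assoc, hp.mul_one_sub_self, one_smul, mul_zero, one_mul, sub_zero]
  intro hc
  let i : ℂˣ := Units.mk0 Complex.I Complex.I_ne_zero
  have hi : i * i = -1 := Units.ext <| by simp [i]
  have h5 : c (-1) = 1 := by
    rw [← hi, map_mul]
    exact DFunLike.congr_fun hc i
  rw [MonoidHom.mul_apply, h5, one_mul, h4] at h3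
  norm_num at h3

end Coefficients

section Existence

variable {R S : Type*} [Ring R] [Algebra ℂ R] [NormedRing S] [NormedAlgebra ℂ S] [CompleteSpace S]
  [IsSimpleRing S] {φ : Rˣ ≃* Sˣ} {e : R}

theorem map_neg_one [Nontrivial R] (φ : Rˣ ≃* Sˣ) : φ (-1) = -1 := by
  have hcomm : ∀ u : Sˣ, Commute (u : S) (φ (-1) : S) := fun u => by
    have h : φ (φ.symm u * -1) = φ (-1 * φ.symm u) := by simp
    rw [map_mul, map_mul, MulEquiv.apply_symm_apply] at h
    exact congrArg Units.val h
  have hcent : ∀ x : S, (φ (-1) : S) * x = x * (φ (-1) : S) := fun x => by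
    obtain ⟨t, u, hu⟩ := exists_isUnit_algebraMap_sub x
    have h := hcomm u
    rw [hu] at h
    have h2 : Commute x (φ (-1) : S) := by
      simpa using (Algebra.commute_algebraMap_left t (φ (-1) : S)).sub_left h
    exact h2.symm
  obtain ⟨t, ht⟩ := exists_eq_algebraMap_of_central hcent
  have hsq : (φ (-1) : S) * (φ (-1) : S) = 1 := by
    rw [← Units.val_mul, ← map_mul]
    simp
  rw [ht, ← map_mul, ← map_one (algebraMap ℂ S)] at hsq
  have ht2 := (algebraMap ℂ S).injective hsq
  rcases mul_self_eq_one_iff.1 ht2 with rfl | rfl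
  · have h1 : φ (-1) = φ 1 := by
      rw [map_one]
      exact Units.ext (by simpa using ht)
    have h2 : (-1 : R) = 1 := by simpa using congrArg Units.val (φ.injective h1)
    have h3 : (0 : R) = 1 := two_mul_left_cancel <| by
      rw [mul_zero, mul_one, ← one_add_one_eq_two]
      nth_rewrite 1 [← h2]
      simp
    exact absurd h3 zero_ne_one
  · exact Units.ext (by simpa using ht)

theorem exists_hasRatio (hφ : φ (-1) = -1) (he : IsIdempotentElem e) (he0 : e ≠ 0)
    (he1 : e ≠ 1) : ∃ c, HasRatio φ e c := by
  have hp := isIdempotentElem_theta (φ := φ) he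
  have hp0 := theta_ne_zero (φ := φ) he he0
  have hp1 := theta_ne_one hφ he he1
  have hq0 := sub_ne_zero.2 hp1.symm
  have key : ∀ t, ∃ α β : ℂ, (φ (dilation he t) : S) =
      α • theta φ e + β • (1 - theta φ e) := fun t => by
    refine exists_eq_smul_add_smul hp hp0 hp1 fun u hu => ?_
    have h1 : u * φ (symUnit he) = φ (symUnit he) * u := Units.ext <| by
      rw [Units.val_mul, Units.val_mul, map_symUnit, mul_sub, sub_mul, mul_assoc, ← hu.eq,
        ← mul_assoc, ← mul_assoc, mul_one, one_mul, mul_two, two_mul]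
    have h2 : φ.symm u * symUnit he = symUnit he * φ.symm u := φ.injective (by simpa using h1)
    have h3 : (φ.symm u : R) * (1 - 2 * e) = (1 - 2 * e) * (φ.symm u : R) :=
      congrArg Units.val h2
    have h4 : (φ.symm u : R) * e = e * (φ.symm u : R) := by
      apply two_mul_left_cancel
      apply sub_right_injective (b := (φ.symm u : R))
      calc (φ.symm u : R) - 2 * ((φ.symm u : R) * e) = (φ.symm u : R) * (1 - 2 * e) := by
            noncomm_ring
        _ = (φ.symm u : R) - 2 * (e * (φ.symm u : R)) := by rw [h3]; noncomm_ring
    have h5 : φ.symm u * dilation he t = dilation he t * φ.symm u := Units.ext <| by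
      simp only [Units.val_mul, val_dilation, mul_sub, sub_mul, mul_add, add_mul, mul_smul_comm,
        smul_mul_assoc, h4, mul_one, one_mul]
    have h6 := congrArg (fun v => (φ v : S)) h5
    simp only [map_mul, MulEquiv.apply_symm_apply, Units.val_mul] at h6
    exact h6
  choose α β h using key
  have hα : ∀ t, (φ (dilation he t) : S) * theta φ e = α t • theta φ e := fun t => by
    rw [h, add_mul, smul_mul_assoc, smul_mul_assoc, hp.one_sub_mul_self, hp.eq, smul_zero,
      add_zero]
  have hβ : ∀ t, (φ (dilation he t) : S) * (1 - theta φ e) = β t • (1 - theta φ e) := fun t => by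
    rw [h, add_mul, smul_mul_assoc, smul_mul_assoc, hp.mul_one_sub_self, hp.one_sub.eq,
      smul_zero, zero_add]
  have character : ∀ (x : S) (γ : ℂˣ → ℂ), x ≠ 0 →
      (∀ t, (φ (dilation he t) : S) * x = γ t • x) → ∃ a : ℂˣ →* ℂˣ, ∀ t, (a t : ℂ) = γ t := by
    intro x γ hx hγ
    let m : ℂˣ →* ℂ :=
      { toFun := γ
        map_one' := smul_left_injective ℂ hx <| by
          simp only
          rw [← hγ, dilation_one, map_one, Units.val_one, one_mul, one_smul]
        map_mul' := fun s t => smul_left_injective ℂ hx <| by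
          beta_reduce
          rw [← hγ, dilation_mul, map_mul, Units.val_mul, mul_assoc, hγ, mul_smul_comm, hγ,
            smul_smul, mul_comm] }
    exact ⟨m.toHomUnits, fun t => rfl⟩
  obtain ⟨a, ha⟩ := character _ α hp0 hα
  obtain ⟨b, hb⟩ := character _ β hq0 hβ
  refine ⟨a / b, a, b, (isCoeffMaps_iff hφ he).2 fun t => ?_, (div_mul_cancel a b).symm⟩
  rw [ha, hb, h]

end Existence

section Auxiliary

variable {G : Type*} [CommGroup G] {b b' b'' c c' c'' : G}

theorem ratio_eq_of_mul_eq (h : c'' * b'' = c * b * b') (h' : c'' * b'' = b * (c' * b')) :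
    c' = c := by
  rw [h, mul_left_comm, ← mul_assoc c', mul_left_inj, mul_left_inj] at h'
  exact h'.symm

theorem ratio_eq_of_mul_eq' (h : c'' * b'' = c * b * b') (h' : b'' = b * b') : c'' = c := by
  rwa [h', mul_assoc c, mul_left_inj] at h

theorem ratio_eq_of_mul_eq'' (h : c'' * b'' = b * (c' * b')) (h' : b'' = b * b') : c'' = c' := by
  rwa [h', mul_left_comm b, mul_left_inj] at h

theorem ratio_eq_inv (h : c'' * b'' = c * b * b') (h' : b'' = c * b * (c * b')) : c'' = c⁻¹ := by
  rw [h', mul_left_comm (c * b), ← mul_assoc, mul_eq_right] at h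
  exact eq_inv_of_mul_eq_one_left h

theorem ratio_mul_eq_one (h : b'' = c * b * (c' * b')) (h' : b'' = b * b') : c * c' = 1 := by
  rwa [h', mul_mul_mul_comm, eq_comm, mul_eq_right] at h

theorem one_sub_mul_one_sub {S : Type*} [Ring S] (p q : S) :
    (1 - p) * (1 - q) = 1 - (p + q) + p * q := by noncomm_ring

theorem add_ne_zero_of_orthogonal {R : Type*} [Ring R] {e f : R} (he : IsIdempotentElem e)
    (he0 : e ≠ 0) (hef : e * f = 0) : e + f ≠ 0 := fun h => he0 <| by
  rw [← he.eq, ← mul_zero e, ← h, mul_add, hef, add_zero]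

/-- Given three commuting nontrivial elements any two of which are disjoint or cover `1`, either
all pairs are disjoint or all pairs cover. -/
theorem disjoint_or_cover_three {S : Type*} [Ring S] {p q r : S} (hp0 : p ≠ 0) (hp1 : p ≠ 1)
    (hq0 : q ≠ 0) (hq1 : q ≠ 1) (hr0 : r ≠ 0) (hr1 : r ≠ 1) (hpq : Commute p q) (hpr : Commute p r)
    (hqr : Commute q r)
    (h1 : p * q = 0 ∨ (1 - p) * (1 - q) = 0) (h2 : p * r = 0 ∨ (1 - p) * (1 - r) = 0)
    (h3 : q * r = 0 ∨ (1 - q) * (1 - r) = 0) :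
    (p * q = 0 ∧ p * r = 0 ∧ q * r = 0) ∨
    ((1 - p) * (1 - q) = 0 ∧ (1 - p) * (1 - r) = 0 ∧ (1 - q) * (1 - r) = 0) := by
  have m1 : ∀ {x y z : S}, x ≠ 0 → x * y = 0 → x * z = 0 → (1 - y) * (1 - z) = 0 → False := by
    intro x y z hx hxy hxz hyz
    apply hx
    have : x * ((1 - y) * (1 - z)) = x - x * y - x * z + x * y * z := by noncomm_ring
    rw [hyz, hxy, hxz] at this
    simpa using this.symm
  have m2 : ∀ {x y z : S}, x ≠ 1 → (1 - x) * (1 - y) = 0 → (1 - x) * (1 - z) = 0 →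
      y * z = 0 → False := by
    intro x y z hx hxy hxz hyz
    refine m1 (x := 1 - x) (y := 1 - y) (z := 1 - z) (sub_ne_zero.2 hx.symm) hxy hxz ?_
    simpa using hyz
  have sw : ∀ {x y : S}, Commute x y → (1 - x) * (1 - y) = 0 → (1 - y) * (1 - x) = 0 := by
    intro x y hxy h
    have : Commute (1 - x) (1 - y) :=
      (Commute.one_right _).sub_right ((Commute.one_left y).sub_left hxy)
    rwa [this.eq] at h
  rcases h1 with h1 | h1 <;> rcases h2 with h2 | h2 <;> rcases h3 with h3 | h3
  · exact .inl ⟨h1, h2, h3⟩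
  · exact (m1 hp0 h1 h2 h3).elim
  · exact (m1 hq0 (hpq.eq ▸ h1) h3 h2).elim
  · exact (m2 hr1 (sw hpr h2) (sw hqr h3) h1).elim
  · exact (m1 hr0 (hpr.eq ▸ h2) (hqr.eq ▸ h3) h1).elim
  · exact (m2 hq1 (sw hpq h1) h3 h2).elim
  · exact (m2 hp1 h1 h2 h3).elim
  · exact .inr ⟨h1, h2, h3⟩

end Auxiliary

section Ratios

variable {R S : Type*} [Ring R] [Algebra ℂ R] [Ring S] [Algebra ℂ S] {φ : Rˣ ≃* Sˣ}
  {e f g : R} {c c' c'' : ℂˣ →* ℂˣ}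

theorem HasRatio.eq_of_theta_mul_eq_zero (hφ : φ (-1) = -1)
    (he : IsIdempotentElem e) (he0 : e ≠ 0) (hf : IsIdempotentElem f) (hf0 : f ≠ 0)
    (hs1 : e + f ≠ 1) (hef : e * f = 0) (hfe : f * e = 0)
    (h : HasRatio φ e c) (h' : HasRatio φ f c') (h'' : HasRatio φ (e + f) c'')
    (hpq : theta φ e * theta φ f = 0) : c' = c ∧ c'' = c := by
  obtain ⟨a, b, h, rfl⟩ := h
  obtain ⟨a', b', h', rfl⟩ := h'
  obtain ⟨a'', b'', h'', rfl⟩ := h''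
  have hs := isIdempotentElem_add he hf hef hfe
  obtain ⟨-, r1, r2, r3⟩ := coeff_relations hφ he hf hef hfe h h' h''
  have n1 := theta_ne_zero (φ := φ) he he0
  have n2 := theta_ne_zero (φ := φ) hf hf0
  have n3 := theta_ne_one hφ hs hs1
  have hP := theta_add (φ := φ) he hf hef hfe
  rw [hpq, mul_zero, sub_zero] at hP
  have r1 := r1 (by rwa [mul_sub, hpq, mul_one, sub_zero])
  have r2 := r2 (by rwa [sub_mul, hpq, one_mul, sub_zero])
  have r3 := r3 fun h0 => n3 <| by
    rw [one_sub_mul_one_sub, hpq, add_zero, sub_eq_zero] at h0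
    rw [hP, h0]
  exact ⟨ratio_eq_of_mul_eq (G := ℂˣ →* ℂˣ) r1 r2, ratio_eq_of_mul_eq' (G := ℂˣ →* ℂˣ) r1 r3⟩

theorem HasRatio.eq_of_theta_cover (hφ : φ (-1) = -1)
    (he : IsIdempotentElem e) (he1 : e ≠ 1) (hf : IsIdempotentElem f) (hf1 : f ≠ 1)
    (hs1 : e + f ≠ 1) (hef : e * f = 0) (hfe : f * e = 0)
    (h : HasRatio φ e c) (h' : HasRatio φ f c') (h'' : HasRatio φ (e + f) c'')
    (hpq : (1 - theta φ e) * (1 - theta φ f) = 0) : c' = c ∧ c'' = c⁻¹ := by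
  obtain ⟨a, b, h, rfl⟩ := h
  obtain ⟨a', b', h', rfl⟩ := h'
  obtain ⟨a'', b'', h'', rfl⟩ := h''
  have hs := isIdempotentElem_add he hf hef hfe
  obtain ⟨r0, r1, r2, -⟩ := coeff_relations hφ he hf hef hfe h h' h''
  have n1 := sub_ne_zero.2 (theta_ne_one hφ he he1).symm
  have n2 := sub_ne_zero.2 (theta_ne_one hφ hf hf1).symm
  have n3 := theta_ne_one hφ hs hs1
  have hP := theta_add (φ := φ) he hf hef hfe
  have e1 : theta φ e * (1 - theta φ f) = 1 - theta φ f := by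
    rwa [sub_mul, one_mul, sub_eq_zero, eq_comm] at hpq
  have e2 : (1 - theta φ e) * theta φ f = 1 - theta φ e := by
    rwa [mul_sub, mul_one, sub_eq_zero, eq_comm] at hpq
  have e3 : theta φ e * theta φ f = theta φ e + theta φ f - 1 := by
    rw [one_sub_mul_one_sub] at hpq
    rw [← sub_eq_zero, ← hpq]
    abel
  have r0 := r0 fun h0 => n3 <| by
    rw [hP, h0, mul_zero, sub_zero, ← sub_eq_zero, ← e3, h0]
  have r1 := r1 (by rwa [e1])
  have r2 := r2 (by rwa [e2])
  obtain rfl := ratio_eq_of_mul_eq (G := ℂˣ →* ℂˣ) r1 r2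
  exact ⟨rfl, ratio_eq_inv (G := ℂˣ →* ℂˣ) r1 r0⟩

theorem HasRatio.eq_of_theta_le (hφ : φ (-1) = -1)
    (he : IsIdempotentElem e) (hf : IsIdempotentElem f) (hf1 : f ≠ 1)
    (hs0 : e + f ≠ 0) (hef : e * f = 0) (hfe : f * e = 0)
    (h : HasRatio φ e c) (h' : HasRatio φ f c') (h'' : HasRatio φ (e + f) c'')
    (hpq : theta φ e * (1 - theta φ f) = 0) : c'' = c' := by
  obtain ⟨a, b, h, rfl⟩ := h
  obtain ⟨a', b', h', rfl⟩ := h'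
  obtain ⟨a'', b'', h'', rfl⟩ := h''
  have hs := isIdempotentElem_add he hf hef hfe
  obtain ⟨-, -, r2, r3⟩ := coeff_relations hφ he hf hef hfe h h' h''
  have n2 := sub_ne_zero.2 (theta_ne_one hφ hf hf1).symm
  have n3 := theta_ne_zero (φ := φ) hs hs0
  have hP := theta_add (φ := φ) he hf hef hfe
  have e1 : theta φ e * theta φ f = theta φ e := by
    rwa [mul_sub, mul_one, sub_eq_zero, eq_comm] at hpq
  have r2 := r2 fun h0 => n3 <| by
    rw [sub_mul, one_mul, e1, sub_eq_zero] at h0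
    rw [hP, e1, h0, two_mul, sub_self]
  have r3 := r3 (by rwa [sub_mul, one_mul, hpq, sub_zero])
  exact ratio_eq_of_mul_eq'' (G := ℂˣ →* ℂˣ) r2 r3

theorem HasRatio.theta_disjoint_or_cover (hφ : φ (-1) = -1)
    (he : IsIdempotentElem e) (hf : IsIdempotentElem f)
    (hef : e * f = 0) (hfe : f * e = 0) (hc : c * c ≠ 1)
    (h : HasRatio φ e c) (h' : HasRatio φ f c) (h'' : HasRatio φ (e + f) c'') :
    theta φ e * theta φ f = 0 ∨ (1 - theta φ e) * (1 - theta φ f) = 0 := by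
  by_contra! hne
  obtain ⟨a, b, h, rfl⟩ := h
  obtain ⟨a', b', h', rfl⟩ := h'
  obtain ⟨a'', b'', h'', rfl⟩ := h''
  obtain ⟨r0, -, -, r3⟩ := coeff_relations hφ he hf hef hfe h h' h''
  apply hc
  exact ratio_mul_eq_one (G := ℂˣ →* ℂˣ) (r0 hne.1) (r3 hne.2)

theorem HasRatio.eq_or_eq_inv_of_add (hφ : φ (-1) = -1)
    (he : IsIdempotentElem e) (he0 : e ≠ 0) (he1 : e ≠ 1)
    (hf : IsIdempotentElem f) (hf0 : f ≠ 0) (hf1 : f ≠ 1)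
    (hs0 : e + f ≠ 0) (hs1 : e + f ≠ 1) (hef : e * f = 0) (hfe : f * e = 0)
    (h : HasRatio φ e c) (h' : HasRatio φ f c') (h'' : HasRatio φ (e + f) c'') :
    c'' = c ∨ c'' = c⁻¹ := by
  by_cases hpq : theta φ e * theta φ f = 0
  · exact .inl (h.eq_of_theta_mul_eq_zero hφ he he0 hf hf0 hs1 hef hfe h' h'' hpq).2
  by_cases hpq' : (1 - theta φ e) * (1 - theta φ f) = 0
  · exact .inr (h.eq_of_theta_cover hφ he he1 hf hf1 hs1 hef hfe h' h'' hpq').2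
  have hcomm : Commute (theta φ e) (theta φ f) :=
    commute_theta he hf (show e * f = f * e by rw [hef, hfe])
  have hcc : c * c' = 1 := by
    obtain ⟨a, b, k, rfl⟩ := id h
    obtain ⟨a', b', k', rfl⟩ := id h'
    obtain ⟨a'', b'', k'', rfl⟩ := id h''
    obtain ⟨r0, -, -, r3⟩ := coeff_relations hφ he hf hef hfe k k' k''
    exact ratio_mul_eq_one (G := ℂˣ →* ℂˣ) (r0 hpq) (r3 hpq')
  by_cases h1 : theta φ e * (1 - theta φ f) = 0
  · right
    rw [h.eq_of_theta_le hφ he hf hf1 hs0 hef hfe h' h'' h1]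
    exact eq_inv_of_mul_eq_one_right (α := ℂˣ →* ℂˣ) hcc
  by_cases h2 : (1 - theta φ e) * theta φ f = 0
  · left
    rw [add_comm] at h'' hs0
    refine h'.eq_of_theta_le hφ hf he he1 hs0 hfe hef h h'' ?_
    rwa [((Commute.one_right _).sub_right hcomm.symm).eq]
  · have hc := h.mul_self_ne_one hφ he he0 he1
    obtain ⟨a, b, h, rfl⟩ := h
    obtain ⟨a', b', h', rfl⟩ := h'
    obtain ⟨a'', b'', h'', rfl⟩ := h''
    obtain ⟨-, r1, r2, -⟩ := coeff_relations hφ he hf hef hfe h h' h''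
    rw [ratio_eq_of_mul_eq (G := ℂˣ →* ℂˣ) (r1 h1) (r2 h2)] at hcc
    exact absurd hcc hc

theorem HasRatio.unique (hφ : φ (-1) = -1) (he : IsIdempotentElem e) (he0 : e ≠ 0) (he1 : e ≠ 1)
    (h : HasRatio φ e c) (h' : HasRatio φ e c') : c = c' := by
  obtain ⟨a, b, h, rfl⟩ := h
  obtain ⟨a', b', h', h_eq⟩ := h'
  have ha : c * b = a' := MonoidHom.ext fun t => Units.ext <|
    smul_left_injective ℂ (theta_ne_zero (φ := φ) he he0)
      ((h.map_mul_theta hφ he t).symm.trans (h'.map_mul_theta hφ he t))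
  have hb : b = b' := MonoidHom.ext fun t => Units.ext <|
    smul_left_injective ℂ (sub_ne_zero.2 (theta_ne_one hφ he he1).symm)
      ((h.map_mul_one_sub_theta hφ he t).symm.trans (h'.map_mul_one_sub_theta hφ he t))
  rw [← ha, ← hb] at h_eq
  exact mul_right_cancel (G := ℂˣ →* ℂˣ) h_eq

end Ratios

section OddSums

variable {R S : Type*} [Ring R] [Algebra ℂ R] [NormedRing S] [NormedAlgebra ℂ S] [CompleteSpace S]
  [IsSimpleRing S] {φ : Rˣ ≃* Sˣ} {e f g : R} {c : ℂˣ →* ℂˣ}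

/-- The ratio of a sum of three orthogonal idempotents with a common ratio. -/
theorem HasRatio.add_add (hφ : φ (-1) = -1) (he : IsIdempotentElem e) (he0 : e ≠ 0)
    (hf : IsIdempotentElem f) (hf0 : f ≠ 0) (hg : IsIdempotentElem g) (hg0 : g ≠ 0)
    (hef : e * f = 0) (hfe : f * e = 0) (heg : e * g = 0) (hge : g * e = 0)
    (hfg : f * g = 0) (hgf : g * f = 0) (hs1 : e + f + g ≠ 1)
    (h : HasRatio φ e c) (h' : HasRatio φ f c) (h'' : HasRatio φ g c) :
    HasRatio φ (e + f + g) c := by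
  have ne_one : ∀ {x y : R}, y ≠ 0 → x * y = 0 → x ≠ 1 := by
    rintro x y hy hxy rfl
    exact hy (by rwa [one_mul] at hxy)
  have he1 := ne_one hf0 hef
  have hf1 := ne_one he0 hfe
  have hg1 := ne_one he0 hge
  have ief := isIdempotentElem_add he hf hef hfe
  have ieg := isIdempotentElem_add he hg heg hge
  have ifg := isIdempotentElem_add hf hg hfg hgf
  have zef := add_ne_zero_of_orthogonal he he0 hef
  have oefg : (e + f) * g = 0 := by rw [add_mul, heg, hfg, add_zero]
  have ogef : g * (e + f) = 0 := by rw [mul_add, hge, hgf, add_zero]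
  have uef : e + f ≠ 1 := ne_one hg0 oefg
  have zs := add_ne_zero_of_orthogonal ief zef oefg
  have is := isIdempotentElem_add ief hg oefg ogef
  obtain ⟨c₁, h₁⟩ := exists_hasRatio hφ ief zef uef
  obtain ⟨c₂, h₂⟩ := exists_hasRatio hφ ieg (add_ne_zero_of_orthogonal he he0 heg)
    (ne_one hf0 (by rw [add_mul, hef, hgf, add_zero]))
  obtain ⟨c₃, h₃⟩ := exists_hasRatio hφ ifg (add_ne_zero_of_orthogonal hf hf0 hfg)
    (ne_one he0 (by rw [add_mul, hfe, hge, add_zero]))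
  obtain ⟨c₄, h₄⟩ := exists_hasRatio hφ is zs hs1
  have hc := h.mul_self_ne_one hφ he he0 he1
  have hP := theta_add (φ := φ) he hf hef hfe
  suffices c₄ = c by rwa [← this]
  rcases disjoint_or_cover_three (theta_ne_zero (φ := φ) he he0) (theta_ne_one hφ he he1)
    (theta_ne_zero hf hf0) (theta_ne_one hφ hf hf1) (theta_ne_zero hg hg0) (theta_ne_one hφ hg hg1)
    (commute_theta he hf (show e * f = f * e by rw [hef, hfe]))
    (commute_theta he hg (show e * g = g * e by rw [heg, hge]))
    (commute_theta hf hg (show f * g = g * f by rw [hfg, hgf]))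
    (h.theta_disjoint_or_cover hφ he hf hef hfe hc h' h₁)
    (h.theta_disjoint_or_cover hφ he hg heg hge hc h'' h₂)
    (h'.theta_disjoint_or_cover hφ hf hg hfg hgf hc h'' h₃) with ⟨d1, d2, d3⟩ | ⟨d1, d2, d3⟩
  · obtain ⟨-, rfl⟩ := h.eq_of_theta_mul_eq_zero hφ he he0 hf hf0 uef hef hfe h' h₁ d1
    refine (h₁.eq_of_theta_mul_eq_zero hφ ief zef hg hg0 hs1 oefg ogef h'' h₄ ?_).2
    rw [hP, d1, mul_zero, sub_zero, add_mul, d2, d3, add_zero]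
  · refine h₁.eq_of_theta_le hφ ief hg hg1 zs oefg ogef h'' h₄ ?_
    have expand : theta φ e + theta φ f - 2 * (theta φ e * theta φ f) =
        (1 - theta φ e) + (1 - theta φ f) - 2 * ((1 - theta φ e) * (1 - theta φ f)) := by
      noncomm_ring
    rw [hP, expand, d1, mul_zero, sub_zero, add_mul, d2, d3, add_zero]

theorem HasRatio.sum_range_odd (hφ : φ (-1) = -1) (g : ℕ → R) (k : ℕ)
    (hg : ∀ i < 2 * k + 1, IsIdempotentElem (g i) ∧ g i ≠ 0)
    (horth : ∀ i < 2 * k + 1, ∀ j < 2 * k + 1, i ≠ j → g i * g j = 0)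
    (hratio : ∀ i < 2 * k + 1, HasRatio φ (g i) c)
    (hs1 : ∑ i ∈ Finset.range (2 * k + 1), g i ≠ 1) :
    IsIdempotentElem (∑ i ∈ Finset.range (2 * k + 1), g i) ∧
    ∑ i ∈ Finset.range (2 * k + 1), g i ≠ 0 ∧
    HasRatio φ (∑ i ∈ Finset.range (2 * k + 1), g i) c := by
  induction k with
  | zero =>
    simpa [and_assoc] using And.intro (hg 0 (by simp)).1 ⟨(hg 0 (by simp)).2, hratio 0 (by simp)⟩
  | succ k ih =>
    rw [show 2 * (k + 1) + 1 = 2 * k + 1 + 1 + 1 by ring] at *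
    rw [Finset.sum_range_succ, Finset.sum_range_succ] at hs1 ⊢
    have l : ∀ j, 2 * k + 1 ≤ j → j < 2 * k + 1 + 1 + 1 →
        (∑ i ∈ Finset.range (2 * k + 1), g i) * g j = 0 := fun j hj hj' => by
      rw [Finset.sum_mul]
      refine Finset.sum_eq_zero fun i hi => ?_
      have := Finset.mem_range.1 hi
      exact horth i (by omega) j hj' (by omega)
    have r : ∀ j, 2 * k + 1 ≤ j → j < 2 * k + 1 + 1 + 1 →
        g j * (∑ i ∈ Finset.range (2 * k + 1), g i) = 0 := fun j hj hj' => by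
      rw [Finset.mul_sum]
      refine Finset.sum_eq_zero fun i hi => ?_
      have := Finset.mem_range.1 hi
      exact horth j hj' i (by omega) (by omega)
    obtain ⟨ie, ze⟩ := hg (2 * k + 1) (by omega)
    obtain ⟨ie', ze'⟩ := hg (2 * k + 1 + 1) (by omega)
    have l1 := l (2 * k + 1) le_rfl (by omega)
    have r1 := r (2 * k + 1) le_rfl (by omega)
    have l2 := l (2 * k + 1 + 1) (by omega) (by omega)
    have r2 := r (2 * k + 1 + 1) (by omega) (by omega)
    have o1 := horth (2 * k + 1) (by omega) (2 * k + 1 + 1) (by omega) (by omega)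
    have o2 := horth (2 * k + 1 + 1) (by omega) (2 * k + 1) (by omega) (by omega)
    obtain ⟨hI, hZ, hR⟩ := ih (fun i hi => hg i (by omega))
      (fun i hi j hj => horth i (by omega) j (by omega)) (fun i hi => hratio i (by omega))
      fun h1 => ze <| by rwa [h1, one_mul] at l1
    have is := isIdempotentElem_add hI ie l1 r1
    have zs := add_ne_zero_of_orthogonal hI hZ l1
    have o3 : (∑ i ∈ Finset.range (2 * k + 1), g i + g (2 * k + 1)) * g (2 * k + 1 + 1) = 0 := by
      rw [add_mul, l2, o1, add_zero]
    have o4 : g (2 * k + 1 + 1) * (∑ i ∈ Finset.range (2 * k + 1), g i + g (2 * k + 1)) = 0 := by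
      rw [mul_add, r2, o2, add_zero]
    exact ⟨isIdempotentElem_add is ie' o3 o4, add_ne_zero_of_orthogonal is zs o3,
      hR.add_add hφ hI hZ ie ze ie' ze' l1 r1 l2 r2 o1 o2 hs1 (hratio _ (by omega))
        (hratio _ (by omega))⟩

end OddSums

section Orthogonal

variable {R : Type*} [Ring R] {n : ℕ} {g : Fin n → R}

theorem mul_sum_of_orthogonal (hg : ∀ i, IsIdempotentElem (g i))
    (horth : ∀ i j, i ≠ j → g i * g j = 0) (i : Fin n) : g i * ∑ j, g j = g i := by
  rw [Finset.mul_sum, Finset.sum_eq_single i (fun j _ hj => horth i j hj.symm) (by simp), (hg i).eq]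

theorem sum_mul_of_orthogonal (hg : ∀ i, IsIdempotentElem (g i))
    (horth : ∀ i j, i ≠ j → g i * g j = 0) (i : Fin n) : (∑ j, g j) * g i = g i := by
  rw [Finset.sum_mul, Finset.sum_eq_single i (fun j _ hj => horth j i hj) (by simp), (hg i).eq]

theorem ne_sum_of_orthogonal (hn : 2 ≤ n) (hg : ∀ i, IsIdempotentElem (g i)) (hg0 : ∀ i, g i ≠ 0)
    (horth : ∀ i j, i ≠ j → g i * g j = 0) (i : Fin n) : g i ≠ ∑ j, g j := fun h => by
  have : Nontrivial (Fin n) := Fin.nontrivial_iff_two_le.2 hn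
  obtain ⟨j, hj⟩ := exists_ne i
  apply hg0 j
  rw [← sum_mul_of_orthogonal hg horth j, ← h, horth i j hj.symm]

end Orthogonal

section Selection

variable {R S : Type*} [Ring R] [Algebra ℂ R] [NormedRing S] [NormedAlgebra ℂ S] [CompleteSpace S]
  [IsSimpleRing S] {φ : Rˣ ≃* Sˣ} {f : R} {c : ℂˣ →* ℂˣ} {n : ℕ} {g : Fin n → R}

/-- In an odd orthogonal decomposition, some summand has the same ratio as the sum. -/
theorem HasRatio.exists_summand (hφ : φ (-1) = -1) (hn : Odd n) (hn3 : 3 ≤ n)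
    (hg : ∀ i, IsIdempotentElem (g i)) (hg0 : ∀ i, g i ≠ 0) (hg1 : ∀ i, g i ≠ 1)
    (horth : ∀ i j, i ≠ j → g i * g j = 0) (hsum : ∑ i, g i = f)
    (hf : IsIdempotentElem f) (hf0 : f ≠ 0) (hf1 : f ≠ 1) (h : HasRatio φ f c) :
    ∃ i, HasRatio φ (g i) c := by
  by_contra! hne
  have hl : ∀ i, g i * f = g i := hsum ▸ mul_sum_of_orthogonal hg horth
  have hr : ∀ i, f * g i = g i := hsum ▸ sum_mul_of_orthogonal hg horth
  have hgf : ∀ i, g i ≠ f := hsum ▸ ne_sum_of_orthogonal (by omega) hg hg0 horth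
  have hinv : ∀ i, HasRatio φ (g i) c⁻¹ := fun i => by
    have hi : IsIdempotentElem (f - g i) := by
      change (f - g i) * (f - g i) = f - g i
      simp only [mul_sub, sub_mul, hl, hr, hf.eq, (hg i).eq, sub_self, sub_zero]
    have o1 : g i * (f - g i) = 0 := by rw [mul_sub, hl, (hg i).eq, sub_self]
    have o2 : (f - g i) * g i = 0 := by rw [sub_mul, hr, (hg i).eq, sub_self]
    have hi0 : f - g i ≠ 0 := sub_ne_zero.2 (hgf i).symm
    have hi1 : f - g i ≠ 1 := fun h1 => hg0 i (by rwa [h1, mul_one] at o1)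
    have hs : g i + (f - g i) = f := add_sub_cancel _ _
    obtain ⟨d, hd⟩ := exists_hasRatio hφ (hg i) (hg0 i) (hg1 i)
    obtain ⟨d', hd'⟩ := exists_hasRatio hφ hi hi0 hi1
    rcases hd.eq_or_eq_inv_of_add hφ (hg i) (hg0 i) (hg1 i) hi hi0 hi1 (by rwa [hs])
      (by rwa [hs]) o1 o2 hd' (by rwa [hs]) with rfl | rfl
    · exact absurd hd (hne i)
    · exact (inv_inv (G := ℂˣ →* ℂˣ) d).symm ▸ hd
  obtain ⟨k, rfl⟩ := hn
  let G : ℕ → R := fun i => if hi : i < 2 * k + 1 then g ⟨i, hi⟩ else 0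
  have hG : ∀ i (hi : i < 2 * k + 1), G i = g ⟨i, hi⟩ := fun i hi => dif_pos hi
  have hGsum : ∑ i ∈ Finset.range (2 * k + 1), G i = f := by
    rw [← hsum, ← Fin.sum_univ_eq_sum_range]
    exact Finset.sum_congr rfl fun i _ => hG i i.2
  have h2 := (HasRatio.sum_range_odd hφ G k (c := c⁻¹)
    (fun i hi => by rw [hG i hi]; exact ⟨hg _, hg0 _⟩)
    (fun i hi j hj hij => by rw [hG i hi, hG j hj]; exact horth _ _ (by simpa using hij))
    (fun i hi => by rw [hG i hi]; exact hinv _) (by rwa [hGsum])).2.2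
  rw [hGsum] at h2
  apply h.mul_self_ne_one hφ hf hf0 hf1
  nth_rewrite 2 [h.unique hφ hf hf0 hf1 h2]
  exact mul_inv_cancel c

end Selection

theorem statement13 [IsSimpleRing A] [IsSimpleRing B]
    (hA : OddlyDecomposable A) (φ : Aˣ ≃* Bˣ)
    (e f : A) (he : IsIdempotentElem e) (he0 : e ≠ 0) (he1 : e ≠ 1)
    (hf : IsIdempotentElem f) (hf0 : f ≠ 0) (hf1 : f ≠ 1) :
    ∃ (e' f' : A) (u : Aˣ),
      IsIdempotentElem e' ∧ e' ≠ 0 ∧ e' ≠ 1 ∧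
      IsIdempotentElem f' ∧ f' ≠ 0 ∧ f' ≠ 1 ∧
      cEquiv (⇑φ) e' f ∧ cEquiv (⇑φ) f' f ∧
      e' * e = e' ∧ e * e' = e' ∧ e' ≠ e ∧
      f' * f = f' ∧ f * f' = f' ∧ f' ≠ f ∧
      e' = (u : A) * f' * ((u⁻¹ : Aˣ) : A) := by
  have hφ := map_neg_one φ
  obtain ⟨n, hn, hn3, g, hg, horth, hsum, hsub⟩ := hA e f he he0 he1 hf hf0 hf1
  obtain ⟨c, hc⟩ := exists_hasRatio hφ hf hf0 hf1
  have hidem := fun i => (hg i).1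
  have hne0 := fun i => (hg i).2.1
  obtain ⟨i, hi⟩ := hc.exists_summand hφ hn hn3 hidem hne0 (fun i => (hg i).2.2) horth hsum
    hf hf0 hf1
  obtain ⟨g', u, hg', hg0', hg1', rfl, hle, hle', hne⟩ := hsub i
  refine ⟨_, g i, u, hg', hg0', hg1', hidem i, hne0 i, (hg i).2.2,
    (hi.conj hφ (hidem i) u hg').cEquiv hc, hi.cEquiv hc, hle, hle', hne, ?_, ?_, ?_, rfl⟩
  · exact hsum ▸ mul_sum_of_orthogonal hidem horth i
  · exact hsum ▸ sum_mul_of_orthogonal hidem horth i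
  · exact hsum ▸ ne_sum_of_orthogonal (by omega) hidem hne0 horth i

end
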